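/- Let 1/2 < s ≤ 1, 1/4 < s' ≤ 1, 1/2 < θ₀ < 1, and 1/2 < θ₁ < 1. Then there exists a constant C > 0 such that for all Schwartz functions u, v, w on ℝ^{1+2}, ‖uvw‖_{H^{s'−1, 0}} ≤ C ‖u‖_{H^{s',θ₁}} ‖v‖_{H^{s,θ₀}} ‖w‖_{H^{s,θ₀}}. -/

import Mathlib

open MeasureTheory Real
open scoped FourierTransform

noncomputable section

/-- Space-time ℝ^{1+2}: coordinate 0 is time `t`, coordinates 1,2 are space `x`. -/
abbrev SpaceTime := EuclideanSpace ℝ (Fin 3)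

/-- The magnitude `|ξ|` of the spatial part of a frequency point `(τ, ξ) ∈ ℝ × ℝ²`. -/
def spFreq (ζ : SpaceTime) : ℝ := Real.sqrt ((ζ 1) ^ 2 + (ζ 2) ^ 2)

/-- The wave-Sobolev norm
`‖u‖_{H^{s,b}} = (∫ (1+|ξ|²)^s (1+||τ|-|ξ||)^{2b} |û(τ,ξ)|² dτ dξ)^{1/2}`. -/
def waveNorm (s b : ℝ) (f : SpaceTime → ℂ) : ℝ :=
  (∫ ζ : SpaceTime, (1 + (spFreq ζ) ^ 2) ^ s * (1 + |(|ζ 0| - spFreq ζ)|) ^ (2 * b) *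
    ‖𝓕 f ζ‖ ^ 2) ^ (1/2 : ℝ)

open scoped ENNReal SchwartzMap

/-- The square of the Japanese bracket of the spatial frequency. -/
def spBracketSq (ζ : SpaceTime) : ℝ := 1 + (spFreq ζ) ^ 2

/-- The bracket of the distance to the light cone. -/
def coneBracket (ζ : SpaceTime) : ℝ := 1 + |(|ζ 0| - spFreq ζ)|

lemma one_le_spBracketSq (ζ : SpaceTime) : 1 ≤ spBracketSq ζ := by
  unfold spBracketSq; nlinarith [sq_nonneg (spFreq ζ)]

lemma one_le_coneBracket (ζ : SpaceTime) : 1 ≤ coneBracket ζ := by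
  unfold coneBracket; linarith [abs_nonneg (|ζ 0| - spFreq ζ)]

lemma spBracketSq_pos (ζ : SpaceTime) : 0 < spBracketSq ζ :=
  one_pos.trans_le (one_le_spBracketSq ζ)

lemma coneBracket_pos (ζ : SpaceTime) : 0 < coneBracket ζ :=
  one_pos.trans_le (one_le_coneBracket ζ)

@[fun_prop]
lemma continuous_spFreq : Continuous spFreq := by
  unfold spFreq; fun_prop

@[fun_prop]
lemma continuous_spBracketSq : Continuous spBracketSq := by
  unfold spBracketSq; fun_prop

@[fun_prop]
lemma continuous_coneBracket : Continuous coneBracket := by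
  unfold coneBracket; fun_prop

lemma spFreq_sq (ζ : SpaceTime) : spFreq ζ ^ 2 = ζ 1 ^ 2 + ζ 2 ^ 2 :=
  Real.sq_sqrt (by positivity)

lemma spFreq_nonneg (ζ : SpaceTime) : 0 ≤ spFreq ζ := Real.sqrt_nonneg _

/-! ### Cauchy-Schwarz bounds for quadrilinear integrals -/

/-- The `L²` norm with values in `ℝ≥0∞`. -/
def ltwo {α : Type*} [MeasureSpace α] (f : α → ℝ≥0∞) : ℝ≥0∞ := (∫⁻ x, f x ^ 2) ^ (1 / 2 : ℝ)

lemma lintegral_mul_le_sqrt_mul_sqrt {α : Type*} [MeasurableSpace α] (μ : Measure α)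
    {P Q : α → ℝ≥0∞} (hP : AEMeasurable P μ) (hQ : AEMeasurable Q μ) :
    ∫⁻ x, P x * Q x ∂μ ≤
      (∫⁻ x, P x ^ 2 ∂μ) ^ (1 / 2 : ℝ) * (∫⁻ x, Q x ^ 2 ∂μ) ^ (1 / 2 : ℝ) := by
  have := ENNReal.lintegral_mul_le_Lp_mul_Lq μ Real.HolderConjugate.two_two hP hQ
  simpa using this

lemma sqrt_mul_sqrt_eq {Z f g h K : ℝ≥0∞} :
    (f * g * h) ^ (1 / 2 : ℝ) * (K * K * Z) ^ (1 / 2 : ℝ) =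
      K * (Z ^ (1 / 2 : ℝ) * f ^ (1 / 2 : ℝ) * g ^ (1 / 2 : ℝ) * h ^ (1 / 2 : ℝ)) := by
  have h2 : (0 : ℝ) ≤ 1 / 2 := by norm_num
  have hKK : (K * K) ^ (1 / 2 : ℝ) = K := by
    rw [← pow_two, ← ENNReal.rpow_two, ← ENNReal.rpow_mul]; norm_num
  rw [ENNReal.mul_rpow_of_nonneg _ _ h2, ENNReal.mul_rpow_of_nonneg _ _ h2,
    ENNReal.mul_rpow_of_nonneg _ _ h2, hKK]
  ring

section Trilinear

variable {E : Type*} [MeasureSpace E]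

lemma lintegral_three_prod {f g h : E → ℝ≥0∞}
    (hf : Measurable f) (hg : Measurable g) (hh : Measurable h) :
    ∫⁻ x, ∫⁻ y, ∫⁻ z, f x * g y * h z = (∫⁻ x, f x) * (∫⁻ x, g x) * (∫⁻ x, h x) := by
  have h1 : ∀ x y, ∫⁻ z, f x * g y * h z = f x * g y * ∫⁻ z, h z :=
    fun x y => lintegral_const_mul _ hh
  have h2 : ∀ x, ∫⁻ y, f x * g y * ∫⁻ z, h z = (f x * ∫⁻ y, g y) * ∫⁻ z, h z := fun x => by
    rw [lintegral_mul_const _ (by fun_prop), lintegral_const_mul _ hg]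
  simp_rw [h1, h2]
  rw [lintegral_mul_const _ (by fun_prop), lintegral_mul_const _ hf]

variable [SFinite (volume : Measure E)]

lemma lintegral_three_mul_le {P Q : E × E × E → ℝ≥0∞} (hP : Measurable P) (hQ : Measurable Q) :
    ∫⁻ x, ∫⁻ y, ∫⁻ z, P (x, y, z) * Q (x, y, z) ≤
      (∫⁻ x, ∫⁻ y, ∫⁻ z, P (x, y, z) ^ 2) ^ (1 / 2 : ℝ) *
        (∫⁻ x, ∫⁻ y, ∫⁻ z, Q (x, y, z) ^ 2) ^ (1 / 2 : ℝ) := by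
  have key : ∀ R : E × E × E → ℝ≥0∞, Measurable R →
      ∫⁻ x, ∫⁻ y, ∫⁻ z, R (x, y, z) = ∫⁻ p, R p := by
    intro R hR
    rw [Measure.volume_eq_prod, lintegral_prod _ hR.aemeasurable]
    refine lintegral_congr fun x => ?_
    rw [Measure.volume_eq_prod, lintegral_prod _ (by fun_prop)]
  rw [key (fun p => P p * Q p) (by fun_prop), key (fun p => P p ^ 2) (by fun_prop),
    key (fun p => Q p ^ 2) (by fun_prop)]
  exact lintegral_mul_le_sqrt_mul_sqrt _ hP.aemeasurable hQ.aemeasurable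

variable [AddCommGroup E] [MeasurableAdd₂ E] [(volume : Measure E).IsAddLeftInvariant]

lemma lintegral_sum_mul_kernels_le {Z f g h k : E → ℝ≥0∞} {K : ℝ≥0∞} (hZ : Measurable Z)
    (hf : Measurable f) (hg : Measurable g) (hh : Measurable h) (hk : Measurable k)
    (hK : ∫⁻ x, k x ^ 2 ≤ K) :
    ∫⁻ x, ∫⁻ y, ∫⁻ z, (f x * g y * h z) * (Z (x + y + z) * (k x * k y)) ≤
      K * (ltwo Z * ltwo f * ltwo g * ltwo h) := by
  refine (lintegral_three_mul_le (P := fun p => f p.1 * g p.2.1 * h p.2.2)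
    (Q := fun p => Z (p.1 + p.2.1 + p.2.2) * (k p.1 * k p.2.1))
    (by fun_prop) (by fun_prop)).trans ?_
  have h1 : ∫⁻ x, ∫⁻ y, ∫⁻ z, (f x * g y * h z) ^ 2 =
      (∫⁻ x, f x ^ 2) * (∫⁻ x, g x ^ 2) * (∫⁻ x, h x ^ 2) := by
    simp_rw [mul_pow]
    exact lintegral_three_prod (hf.pow_const 2) (hg.pow_const 2) (hh.pow_const 2)
  have h2 : ∫⁻ x, ∫⁻ y, ∫⁻ z, (Z (x + y + z) * (k x * k y)) ^ 2 ≤ K * K * ∫⁻ x, Z x ^ 2 := by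
    have h3 : ∀ x y, ∫⁻ z, (Z (x + y + z) * (k x * k y)) ^ 2 =
        ∫⁻ z, k x ^ 2 * k y ^ 2 * Z z ^ 2 := fun x y => by
      rw [← lintegral_add_left_eq_self (fun z => k x ^ 2 * k y ^ 2 * Z z ^ 2) (x + y)]
      exact lintegral_congr fun z => by ring
    simp_rw [h3]
    rw [lintegral_three_prod (hk.pow_const 2) (hk.pow_const 2) (hZ.pow_const 2)]
    gcongr
  dsimp only
  rw [h1]
  refine (mul_le_mul_right (ENNReal.rpow_le_rpow h2 (by norm_num)) _).trans ?_
  rw [sqrt_mul_sqrt_eq]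
  rfl

lemma lintegral_sum_mul_shifted_kernel_le {Z f g h k j m : E → ℝ≥0∞} {K : ℝ≥0∞}
    (hZ : Measurable Z) (hf : Measurable f) (hg : Measurable g) (hh : Measurable h)
    (hk : Measurable k) (hj : Measurable j) (hm : Measurable m)
    (hK : ∫⁻ x, k x ^ 2 ≤ K) (hK' : ∀ c, ∫⁻ x, (j (c + x) * m x) ^ 2 ≤ K) :
    ∫⁻ x, ∫⁻ y, ∫⁻ z, (f x * g y * h z) * (Z (x + y + z) * (j (x + y + z) * k x * m y)) ≤
      K * (ltwo Z * ltwo f * ltwo g * ltwo h) := by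
  have h0 : ∀ x y z, (f x * g y * h z) * (Z (x + y + z) * (j (x + y + z) * k x * m y)) =
      (f x * g y * Z (x + y + z)) * (h z * (k x * (j (x + z + y) * m y))) := fun x y z => by
    rw [add_right_comm x z y]; ring
  simp_rw [h0]
  refine (lintegral_three_mul_le (P := fun p => f p.1 * g p.2.1 * Z (p.1 + p.2.1 + p.2.2))
    (Q := fun p => h p.2.2 * (k p.1 * (j (p.1 + p.2.2 + p.2.1) * m p.2.1)))
    (by fun_prop) (by fun_prop)).trans ?_
  have h1 : ∫⁻ x, ∫⁻ y, ∫⁻ z, (f x * g y * Z (x + y + z)) ^ 2 =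
      (∫⁻ x, f x ^ 2) * (∫⁻ x, g x ^ 2) * (∫⁻ x, Z x ^ 2) := by
    rw [← lintegral_three_prod (hf.pow_const 2) (hg.pow_const 2) (hZ.pow_const 2)]
    refine lintegral_congr fun x => lintegral_congr fun y => ?_
    rw [← lintegral_add_left_eq_self (fun z => f x ^ 2 * g y ^ 2 * Z z ^ 2) (x + y)]
    exact lintegral_congr fun z => by ring
  have h2 : ∫⁻ x, ∫⁻ y, ∫⁻ z, (h z * (k x * (j (x + z + y) * m y))) ^ 2 ≤
      K * K * ∫⁻ x, h x ^ 2 := by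
    calc ∫⁻ x, ∫⁻ y, ∫⁻ z, (h z * (k x * (j (x + z + y) * m y))) ^ 2
        = ∫⁻ x, ∫⁻ z, ∫⁻ y, (h z * (k x * (j (x + z + y) * m y))) ^ 2 :=
          lintegral_congr fun x => lintegral_lintegral_swap (by fun_prop)
      _ ≤ ∫⁻ x, ∫⁻ z, k x ^ 2 * h z ^ 2 * K := by
          refine lintegral_mono fun x => lintegral_mono fun z => ?_
          have : ∀ y, (h z * (k x * (j (x + z + y) * m y))) ^ 2 =
            k x ^ 2 * h z ^ 2 * (j (x + z + y) * m y) ^ 2 := fun y => by ring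
          simp_rw [this]
          rw [lintegral_const_mul _ (by fun_prop)]
          gcongr
          exact hK' _
      _ = (∫⁻ x, k x ^ 2) * K * ∫⁻ z, h z ^ 2 := by
          have : ∀ x, ∫⁻ z, k x ^ 2 * h z ^ 2 * K = k x ^ 2 * ((∫⁻ z, h z ^ 2) * K) := fun x => by
            rw [lintegral_mul_const _ (by fun_prop), lintegral_const_mul _ (by fun_prop), mul_assoc]
          simp_rw [this]
          rw [lintegral_mul_const _ (by fun_prop)]
          ring
      _ ≤ _ := by gcongr
  dsimp only
  rw [h1]
  refine (mul_le_mul_right (ENNReal.rpow_le_rpow h2 (by norm_num)) _).trans ?_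
  rw [sqrt_mul_sqrt_eq]
  unfold ltwo
  exact le_of_eq (by ring)

end Trilinear

/-! ### The weight kernels -/

lemma lintegral_spaceTime {G : SpaceTime → ℝ≥0∞} (hG : Measurable G) :
    ∫⁻ ζ, G ζ = ∫⁻ a, ∫⁻ b, ∫⁻ t, G !₂[t, a, b] := by
  have e1 := (PiLp.volume_preserving_toLp (Fin 3)).lintegral_comp hG
  have e2 := (volume_preserving_piFinSuccAbove (fun _ : Fin 3 => ℝ) 0).symm.lintegral_comp
    (f := fun p => G (WithLp.toLp 2 p)) (by fun_prop)
  have e3 := (volume_preserving_finTwoArrow ℝ).symm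
  rw [← e1, ← e2, Measure.volume_eq_prod, lintegral_prod_symm _ (by fun_prop),
    ← e3.lintegral_comp (by fun_prop), Measure.volume_eq_prod, lintegral_prod _ (by fun_prop)]
  refine lintegral_congr fun a => lintegral_congr fun b => lintegral_congr fun t => ?_
  congr 2
  ext i
  fin_cases i <;> rfl

lemma spBracketSq_rpow_le (σ : ℝ) (hσ : 0 ≤ σ) (ζ : SpaceTime) :
    spBracketSq ζ ^ (-(2 * σ)) ≤ (1 + ζ 1 ^ 2) ^ (-σ) * (1 + ζ 2 ^ 2) ^ (-σ) := by
  have h1 : (0 : ℝ) < 1 + ζ 1 ^ 2 := by positivity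
  have h2 : (0 : ℝ) < 1 + ζ 2 ^ 2 := by positivity
  rw [← Real.mul_rpow h1.le h2.le, show -(2 * σ) = 2 * (-σ) by ring,
    Real.rpow_mul (spBracketSq_pos ζ).le]
  refine Real.rpow_le_rpow_of_nonpos (by positivity) ?_ (by linarith)
  rw [Real.rpow_two]
  unfold spBracketSq
  rw [spFreq_sq]
  nlinarith [sq_nonneg (ζ 1), sq_nonneg (ζ 2), mul_nonneg (sq_nonneg (ζ 1)) (sq_nonneg (ζ 2)),
    sq_nonneg (ζ 1 ^ 2 + ζ 2 ^ 2)]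

lemma coneBracket_rpow_le (θ : ℝ) (ζ : SpaceTime) :
    coneBracket ζ ^ (-(2 * θ)) ≤
      (1 + |spFreq ζ + ζ 0|) ^ (-(2 * θ)) + (1 + |-spFreq ζ + ζ 0|) ^ (-(2 * θ)) := by
  unfold coneBracket
  have p1 : 0 ≤ (1 + |spFreq ζ + ζ 0|) ^ (-(2 * θ)) := by positivity
  have p2 : 0 ≤ (1 + |-spFreq ζ + ζ 0|) ^ (-(2 * θ)) := by positivity
  rcases abs_cases (ζ 0) with ⟨h, -⟩ | ⟨h, -⟩
  · rw [h, show ζ 0 - spFreq ζ = -spFreq ζ + ζ 0 by ring]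
    linarith
  · rw [h, show -ζ 0 - spFreq ζ = -(spFreq ζ + ζ 0) by ring, abs_neg]
    linarith

lemma lintegral_one_add_abs_rpow_lt_top {θ : ℝ} (hθ : 1 / 2 < θ) :
    ∫⁻ t : ℝ, ENNReal.ofReal ((1 + |t|) ^ (-(2 * θ))) < ∞ := by
  have := integrable_one_add_norm (E := ℝ) (μ := volume) (r := 2 * θ) (by simp; linarith)
  exact this.lintegral_lt_top

lemma lintegral_one_add_sq_rpow_lt_top {σ : ℝ} (hσ : 1 / 2 < σ) :
    ∫⁻ t : ℝ, ENNReal.ofReal ((1 + t ^ 2) ^ (-σ)) < ∞ := by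
  have := integrable_rpow_neg_one_add_norm_sq (E := ℝ) (μ := volume) (r := 2 * σ)
    (by simp; linarith)
  simp only [Real.norm_eq_abs, sq_abs, show -(2 * σ) / 2 = -σ by ring] at this
  exact this.lintegral_lt_top

/-- The spatial weight `(1+|ξ|²)^{-σ}` as an extended nonnegative function. -/
def spKernel (σ : ℝ) (ζ : SpaceTime) : ℝ≥0∞ := ENNReal.ofReal (spBracketSq ζ ^ (-σ))

/-- The modulation weight `(1+||τ|-|ξ||)^{-θ}` as an extended nonnegative function. -/
def coneKernel (θ : ℝ) (ζ : SpaceTime) : ℝ≥0∞ := ENNReal.ofReal (coneBracket ζ ^ (-θ))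

@[fun_prop]
lemma measurable_spKernel (σ : ℝ) : Measurable (spKernel σ) := by
  unfold spKernel
  exact (continuous_spBracketSq.measurable.pow_const _).ennreal_ofReal

@[fun_prop]
lemma measurable_coneKernel (θ : ℝ) : Measurable (coneKernel θ) := by
  unfold coneKernel
  exact (continuous_coneBracket.measurable.pow_const _).ennreal_ofReal

lemma kernel_sq_le {σ : ℝ} (hσ : 0 ≤ σ) (θ : ℝ) (c ζ : SpaceTime) :
    (spKernel σ (c + ζ) * coneKernel θ ζ) ^ 2 ≤
      ENNReal.ofReal ((1 + (c 1 + ζ 1) ^ 2) ^ (-σ)) *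
        ENNReal.ofReal ((1 + (c 2 + ζ 2) ^ 2) ^ (-σ)) *
        (ENNReal.ofReal ((1 + |spFreq ζ + ζ 0|) ^ (-(2 * θ))) +
          ENNReal.ofReal ((1 + |-spFreq ζ + ζ 0|) ^ (-(2 * θ)))) := by
  unfold spKernel coneKernel
  rw [mul_pow, ← ENNReal.ofReal_pow (by have := spBracketSq_pos (c + ζ); positivity),
    ← ENNReal.ofReal_pow (by have := coneBracket_pos ζ; positivity),
    ← ENNReal.ofReal_mul (p := (1 + (c 1 + ζ 1) ^ 2) ^ (-σ)) (by positivity),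
    ← ENNReal.ofReal_add (by positivity) (by positivity)]
  refine mul_le_mul' (ENNReal.ofReal_le_ofReal ?_) (ENNReal.ofReal_le_ofReal ?_)
  · rw [← Real.rpow_mul_natCast (spBracketSq_pos _).le]
    simpa [mul_comm] using spBracketSq_rpow_le σ hσ (c + ζ)
  · rw [← Real.rpow_mul_natCast (coneBracket_pos _).le]
    simpa [mul_comm] using coneBracket_rpow_le θ ζ

lemma exists_lintegral_kernel_sq_le {σ θ : ℝ} (hσ : 1 / 2 < σ) (hθ : 1 / 2 < θ) :
    ∃ K : ℝ≥0∞, K ≠ ∞ ∧ ∀ c, ∫⁻ ζ, (spKernel σ (c + ζ) * coneKernel θ ζ) ^ 2 ≤ K := by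
  set A := ∫⁻ t : ℝ, ENNReal.ofReal ((1 + |t|) ^ (-(2 * θ))) with hA
  set B := ∫⁻ t : ℝ, ENNReal.ofReal ((1 + t ^ 2) ^ (-σ)) with hB
  have hAt : A ≠ ∞ := (lintegral_one_add_abs_rpow_lt_top hθ).ne
  have hBt : B ≠ ∞ := (lintegral_one_add_sq_rpow_lt_top hσ).ne
  refine ⟨B * B * (A + A), by finiteness, fun c => ?_⟩
  rw [lintegral_spaceTime (by fun_prop)]
  have hin : ∀ a b : ℝ, ∫⁻ t, (spKernel σ (c + !₂[t, a, b]) * coneKernel θ !₂[t, a, b]) ^ 2 ≤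
      ENNReal.ofReal ((1 + (c 1 + a) ^ 2) ^ (-σ)) *
        ENNReal.ofReal ((1 + (c 2 + b) ^ 2) ^ (-σ)) * (A + A) := by
    intro a b
    have hr : ∀ t, spFreq !₂[t, a, b] = √(a ^ 2 + b ^ 2) := fun t => by simp [spFreq]
    refine (lintegral_mono fun t => kernel_sq_le (by linarith) θ c _).trans ?_
    simp only [hr]
    simp only [Matrix.cons_val_zero, Matrix.cons_val_one, Matrix.cons_val]
    rw [lintegral_const_mul _ (by fun_prop), lintegral_add_left (by fun_prop),
      lintegral_add_left_eq_self (fun t => ENNReal.ofReal ((1 + |t|) ^ (-(2 * θ)))),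
      lintegral_add_left_eq_self (fun t => ENNReal.ofReal ((1 + |t|) ^ (-(2 * θ))))]
  calc _ ≤ ∫⁻ a : ℝ, ∫⁻ b : ℝ, ENNReal.ofReal ((1 + (c 1 + a) ^ 2) ^ (-σ)) *
        ENNReal.ofReal ((1 + (c 2 + b) ^ 2) ^ (-σ)) * (A + A) :=
        lintegral_mono fun a => lintegral_mono fun b => hin a b
    _ = B * B * (A + A) := by
      have h1 : ∀ a : ℝ, ∫⁻ b : ℝ, ENNReal.ofReal ((1 + (c 1 + a) ^ 2) ^ (-σ)) *
          ENNReal.ofReal ((1 + (c 2 + b) ^ 2) ^ (-σ)) * (A + A) =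
          ENNReal.ofReal ((1 + (c 1 + a) ^ 2) ^ (-σ)) * (B * (A + A)) := fun a => by
        rw [lintegral_mul_const _ (by fun_prop), lintegral_const_mul _ (by fun_prop),
          lintegral_add_left_eq_self (fun t => ENNReal.ofReal ((1 + t ^ 2) ^ (-σ))), mul_assoc]
      simp_rw [h1]
      rw [lintegral_mul_const _ (by fun_prop),
        lintegral_add_left_eq_self (fun t => ENNReal.ofReal ((1 + t ^ 2) ^ (-σ))), mul_assoc]

/-! ### Distribution of the weights -/

lemma rpow_weights_le_of_le {a b c d p q r t σ : ℝ} (hd : 0 < d) (hdc : d ≤ c) (hca : c ≤ a)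
    (hcb : c ≤ b) (hp : 0 ≤ p) (hq : 0 ≤ q) (ht : t ≤ σ) (hsum : p + q + r + t = 2 * σ) :
    a ^ (-p) * b ^ (-q) * c ^ (-r) * d ^ (-t) ≤ c ^ (-σ) * d ^ (-σ) := by
  have hc : 0 < c := hd.trans_le hdc
  calc a ^ (-p) * b ^ (-q) * c ^ (-r) * d ^ (-t)
      ≤ c ^ (-p) * c ^ (-q) * c ^ (-r) * d ^ (-t) := by
        have h1 := Real.rpow_le_rpow_of_nonpos hc hca (neg_nonpos.2 hp)
        have h2 := Real.rpow_le_rpow_of_nonpos hc hcb (neg_nonpos.2 hq)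
        have hb : 0 < b := hc.trans_le hcb
        gcongr
    _ = c ^ (-σ) * c ^ (-(σ - t)) * d ^ (-t) := by
        rw [← Real.rpow_add hc, ← Real.rpow_add hc, ← Real.rpow_add hc]
        congr 2; linarith
    _ ≤ c ^ (-σ) * d ^ (-(σ - t)) * d ^ (-t) := by
        have h1 := Real.rpow_le_rpow_of_nonpos hd hdc (z := -(σ - t)) (by linarith)
        gcongr
    _ = c ^ (-σ) * d ^ (-σ) := by
        rw [mul_assoc, ← Real.rpow_add hd]; congr 2; ring

lemma rpow_weights_le_of_le_of_le {a b c d p q r t σ : ℝ} (hc : 0 < c) (hd : 0 < d) (hca : c ≤ a)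
    (hcb : c ≤ b) (hda : d ≤ a) (hdb : d ≤ b) (hp : 0 ≤ p) (hq : 0 ≤ q) (hr : r ≤ σ) (ht : t ≤ σ)
    (hsum : p + q + r + t = 2 * σ) :
    a ^ (-p) * b ^ (-q) * c ^ (-r) * d ^ (-t) ≤ c ^ (-σ) * d ^ (-σ) := by
  rcases le_total d c with h | h
  · exact rpow_weights_le_of_le hd h hca hcb hp hq ht hsum
  · rw [mul_right_comm, mul_comm (c ^ (-σ))]
    exact rpow_weights_le_of_le hc h hda hdb hp hq hr (by linarith)

lemma rpow_weights_le_sum {a b c d p q r t σ : ℝ} (ha : 0 < a) (hb : 0 < b) (hc : 0 < c)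
    (hd : 0 < d) (hp : 0 ≤ p) (hq : 0 ≤ q) (hr : 0 ≤ r) (ht : 0 ≤ t) (hpσ : p ≤ σ) (hqσ : q ≤ σ)
    (hrσ : r ≤ σ) (htσ : t ≤ σ) (hsum : p + q + r + t = 2 * σ) :
    a ^ (-p) * b ^ (-q) * c ^ (-r) * d ^ (-t) ≤
      a ^ (-σ) * b ^ (-σ) + a ^ (-σ) * c ^ (-σ) + a ^ (-σ) * d ^ (-σ) + b ^ (-σ) * c ^ (-σ) +
        b ^ (-σ) * d ^ (-σ) + c ^ (-σ) * d ^ (-σ) := by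
  have pab : 0 < a ^ (-σ) * b ^ (-σ) := by positivity
  have pac : 0 < a ^ (-σ) * c ^ (-σ) := by positivity
  have pad : 0 < a ^ (-σ) * d ^ (-σ) := by positivity
  have pbc : 0 < b ^ (-σ) * c ^ (-σ) := by positivity
  have pbd : 0 < b ^ (-σ) * d ^ (-σ) := by positivity
  have pcd : 0 < c ^ (-σ) * d ^ (-σ) := by positivity
  have lab (h1 : a ≤ c) (h2 : a ≤ d) (h3 : b ≤ c) (h4 : b ≤ d) :=
    rpow_weights_le_of_le_of_le ha hb h1 h2 h3 h4 hr ht hpσ hqσ (by linarith)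
  have lac (h1 : a ≤ b) (h2 : a ≤ d) (h3 : c ≤ b) (h4 : c ≤ d) :=
    rpow_weights_le_of_le_of_le ha hc h1 h2 h3 h4 hq ht hpσ hrσ (by linarith)
  have lad (h1 : a ≤ b) (h2 : a ≤ c) (h3 : d ≤ b) (h4 : d ≤ c) :=
    rpow_weights_le_of_le_of_le ha hd h1 h2 h3 h4 hq hr hpσ htσ (by linarith)
  have lbc (h1 : b ≤ a) (h2 : b ≤ d) (h3 : c ≤ a) (h4 : c ≤ d) :=
    rpow_weights_le_of_le_of_le hb hc h1 h2 h3 h4 hp ht hqσ hrσ (by linarith)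
  have lbd (h1 : b ≤ a) (h2 : b ≤ c) (h3 : d ≤ a) (h4 : d ≤ c) :=
    rpow_weights_le_of_le_of_le hb hd h1 h2 h3 h4 hp hr hqσ htσ (by linarith)
  have lcd (h1 : c ≤ a) (h2 : c ≤ b) (h3 : d ≤ a) (h4 : d ≤ b) :=
    rpow_weights_le_of_le_of_le hc hd h1 h2 h3 h4 hp hq hrσ htσ (by linarith)
  rcases le_total a b with h1 | h1 <;> rcases le_total c d with h2 | h2
  · rcases le_total b c with h3 | h3
    · linarith [lab (by linarith) (by linarith) (by linarith) (by linarith)]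
    · rcases le_total d a with h4 | h4
      · linarith [lcd (by linarith) (by linarith) (by linarith) (by linarith)]
      · linarith [lac (by linarith) (by linarith) (by linarith) (by linarith)]
  · rcases le_total b d with h3 | h3
    · linarith [lab (by linarith) (by linarith) (by linarith) (by linarith)]
    · rcases le_total c a with h4 | h4
      · linarith [lcd (by linarith) (by linarith) (by linarith) (by linarith)]
      · linarith [lad (by linarith) (by linarith) (by linarith) (by linarith)]
  · rcases le_total a c with h3 | h3
    · linarith [lab (by linarith) (by linarith) (by linarith) (by linarith)]
    · rcases le_total d b with h4 | h4
      · linarith [lcd (by linarith) (by linarith) (by linarith) (by linarith)]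
      · linarith [lbc (by linarith) (by linarith) (by linarith) (by linarith)]
  · rcases le_total a d with h3 | h3
    · linarith [lab (by linarith) (by linarith) (by linarith) (by linarith)]
    · rcases le_total c b with h4 | h4
      · linarith [lcd (by linarith) (by linarith) (by linarith) (by linarith)]
      · linarith [lbd (by linarith) (by linarith) (by linarith) (by linarith)]

section Rearrangement

variable {E : Type*} [MeasureSpace E] [SFinite (volume : Measure E)]

lemma lintegral_rotate {φ : E × E × E → ℝ≥0∞} (hφ : Measurable φ) :
    ∫⁻ x, ∫⁻ y, ∫⁻ z, φ (x, y, z) = ∫⁻ z, ∫⁻ x, ∫⁻ y, φ (x, y, z) := by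
  calc ∫⁻ x, ∫⁻ y, ∫⁻ z, φ (x, y, z) = ∫⁻ x, ∫⁻ z, ∫⁻ y, φ (x, y, z) :=
        lintegral_congr fun x => lintegral_lintegral_swap (by fun_prop)
    _ = _ := lintegral_lintegral_swap
      (Measurable.lintegral_prod_right' (f := fun p : (E × E) × E => φ (p.1.1, p.2, p.1.2))
        (by fun_prop)).aemeasurable

lemma lintegral_swap_left {φ : E × E × E → ℝ≥0∞} (hφ : Measurable φ) :
    ∫⁻ x, ∫⁻ y, ∫⁻ z, φ (x, y, z) = ∫⁻ y, ∫⁻ x, ∫⁻ z, φ (x, y, z) :=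
  lintegral_lintegral_swap
    (Measurable.lintegral_prod_right' (f := fun p : (E × E) × E => φ (p.1.1, p.1.2, p.2))
      (by fun_prop)).aemeasurable

lemma lintegral_three_add_le {φ ψ : E → E → E → ℝ≥0∞} {A B : ℝ≥0∞}
    (hφ : Measurable fun p : E × E × E => φ p.1 p.2.1 p.2.2)
    (hA : ∫⁻ x, ∫⁻ y, ∫⁻ z, φ x y z ≤ A) (hB : ∫⁻ x, ∫⁻ y, ∫⁻ z, ψ x y z ≤ B) :
    ∫⁻ x, ∫⁻ y, ∫⁻ z, (φ x y z + ψ x y z) ≤ A + B := by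
  refine le_trans (le_of_eq ?_) (add_le_add hA hB)
  have h2 : Measurable fun p : E × E => ∫⁻ z, φ p.1 p.2 z :=
    Measurable.lintegral_prod_right' (f := fun p : (E × E) × E => φ p.1.1 p.1.2 p.2)
      (hφ.comp (by fun_prop : Measurable fun p : (E × E) × E => (p.1.1, p.1.2, p.2)))
  have h3 : Measurable fun x => ∫⁻ y, ∫⁻ z, φ x y z := h2.lintegral_prod_right'
  rw [← lintegral_add_left h3]
  refine lintegral_congr fun x => ?_
  have h4 : Measurable fun y => ∫⁻ z, φ x y z := h2.comp measurable_prodMk_left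
  rw [← lintegral_add_left h4]
  refine lintegral_congr fun y => ?_
  have h5 : Measurable fun z => φ x y z :=
    hφ.comp (by fun_prop : Measurable fun z : E => (x, y, z))
  rw [← lintegral_add_left h5]

variable [AddCommGroup E] [MeasurableAdd₂ E]
  [(volume : Measure E).IsAddLeftInvariant]

lemma lintegral_mul_convolution_three [MeasurableNeg E] {A f g h : E → ℝ≥0∞} (hA : Measurable A)
    (hf : Measurable f) (hg : Measurable g) (hh : Measurable h) :
    ∫⁻ ζ, A ζ * ∫⁻ y, ∫⁻ x, f x * g (y - x) * h (ζ - y) =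
      ∫⁻ x, ∫⁻ y, ∫⁻ z, f x * g y * h z * A (x + y + z) := by
  have h1 : ∀ ζ, A ζ * ∫⁻ y, ∫⁻ x, f x * g (y - x) * h (ζ - y) =
      ∫⁻ y, ∫⁻ x, f x * g (y - x) * h (ζ - y) * A ζ := fun ζ => by
    rw [mul_comm, ← lintegral_mul_const]
    · exact lintegral_congr fun y => (lintegral_mul_const _ (by fun_prop)).symm
    · exact Measurable.lintegral_prod_right'
        (f := fun p : E × E => f p.2 * g (p.1 - p.2) * h (ζ - p.1)) (by fun_prop)
  simp_rw [h1]
  rw [lintegral_rotate (φ := fun p => f p.2.2 * g (p.2.1 - p.2.2) * h (p.1 - p.2.1) * A p.1)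
    (by fun_prop)]
  refine lintegral_congr fun x => ?_
  dsimp only
  rw [lintegral_lintegral_swap (by fun_prop)]
  rw [← lintegral_add_left_eq_self _ x]
  refine lintegral_congr fun y => ?_
  rw [← lintegral_add_left_eq_self _ (x + y)]
  exact lintegral_congr fun z => by simp

lemma lintegral_pair_weights_le {Z f g h k j m : E → ℝ≥0∞} {K : ℝ≥0∞}
    (hZ : Measurable Z) (hf : Measurable f) (hg : Measurable g) (hh : Measurable h)
    (hk : Measurable k) (hj : Measurable j) (hm : Measurable m)
    (hK : ∫⁻ x, k x ^ 2 ≤ K) (hK' : ∀ c, ∫⁻ x, (j (c + x) * m x) ^ 2 ≤ K) :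
    ∫⁻ x, ∫⁻ y, ∫⁻ z, (f x * g y * h z) * (Z (x + y + z) *
      (j (x + y + z) * k x * m y + j (x + y + z) * k y * m x + j (x + y + z) * k z * m x +
        k x * k y + k x * k z + k y * k z)) ≤
      6 * K * (ltwo Z * ltwo f * ltwo g * ltwo h) := by
  set T := K * (ltwo Z * ltwo f * ltwo g * ltwo h) with hT
  have b01 := lintegral_sum_mul_shifted_kernel_le hZ hf hg hh hk hj hm hK hK'
  have b02 : ∫⁻ x, ∫⁻ y, ∫⁻ z, (f x * g y * h z) * (Z (x + y + z) *
      (j (x + y + z) * k y * m x)) ≤ T := by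
    rw [lintegral_swap_left (φ := fun p => (f p.1 * g p.2.1 * h p.2.2) *
      (Z (p.1 + p.2.1 + p.2.2) * (j (p.1 + p.2.1 + p.2.2) * k p.2.1 * m p.1))) (by fun_prop)]
    have := lintegral_sum_mul_shifted_kernel_le hZ hg hf hh hk hj hm hK hK'
    refine (le_of_eq ?_).trans (this.trans_eq (by rw [hT]; ring))
    refine lintegral_congr fun y => lintegral_congr fun x => lintegral_congr fun z => ?_
    rw [show y + x + z = x + y + z by abel]
    ring
  have b03 : ∫⁻ x, ∫⁻ y, ∫⁻ z, (f x * g y * h z) * (Z (x + y + z) *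
      (j (x + y + z) * k z * m x)) ≤ T := by
    rw [lintegral_rotate (φ := fun p => (f p.1 * g p.2.1 * h p.2.2) *
      (Z (p.1 + p.2.1 + p.2.2) * (j (p.1 + p.2.1 + p.2.2) * k p.2.2 * m p.1))) (by fun_prop)]
    have := lintegral_sum_mul_shifted_kernel_le hZ hh hf hg hk hj hm hK hK'
    refine (le_of_eq ?_).trans (this.trans_eq (by rw [hT]; ring))
    refine lintegral_congr fun z => lintegral_congr fun x => lintegral_congr fun y => ?_
    rw [show z + x + y = x + y + z by abel]
    ring
  have b12 := lintegral_sum_mul_kernels_le hZ hf hg hh hk hK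
  have b13 : ∫⁻ x, ∫⁻ y, ∫⁻ z, (f x * g y * h z) * (Z (x + y + z) * (k x * k z)) ≤ T := by
    rw [lintegral_rotate (φ := fun p => (f p.1 * g p.2.1 * h p.2.2) *
      (Z (p.1 + p.2.1 + p.2.2) * (k p.1 * k p.2.2))) (by fun_prop)]
    have := lintegral_sum_mul_kernels_le hZ hh hf hg hk hK
    refine (le_of_eq ?_).trans (this.trans_eq (by rw [hT]; ring))
    refine lintegral_congr fun z => lintegral_congr fun x => lintegral_congr fun y => ?_
    rw [show z + x + y = x + y + z by abel]
    ring
  have b23 : ∫⁻ x, ∫⁻ y, ∫⁻ z, (f x * g y * h z) * (Z (x + y + z) * (k y * k z)) ≤ T := by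
    have := lintegral_sum_mul_kernels_le hZ hg hh hf hk hK
    rw [lintegral_rotate (φ := fun p => (g p.1 * h p.2.1 * f p.2.2) *
      (Z (p.1 + p.2.1 + p.2.2) * (k p.1 * k p.2.1))) (by fun_prop)] at this
    refine (le_of_eq ?_).trans (this.trans_eq (by rw [hT]; ring))
    refine lintegral_congr fun x => lintegral_congr fun y => lintegral_congr fun z => ?_
    dsimp only
    rw [show y + z + x = x + y + z by abel]
    ring
  have key := lintegral_three_add_le (by fun_prop) (lintegral_three_add_le (by fun_prop)
    (lintegral_three_add_le (by fun_prop) (lintegral_three_add_le (by fun_prop)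
    (lintegral_three_add_le (by fun_prop) b01 b02) b03) b12) b13) b23
  simp_rw [mul_add]
  exact key.trans_eq (by rw [hT]; ring)

end Rearrangement

/-! ### Products on the Fourier side -/

lemma SchwartzMap.exists_eq_mul (f g : 𝓢(SpaceTime, ℂ)) :
    ∃ p : 𝓢(SpaceTime, ℂ), ∀ x, p x = f x * g x :=
  ⟨SchwartzMap.pairing (ContinuousLinearMap.mul ℂ ℂ) f g, fun _ => rfl⟩

lemma SchwartzMap.exists_coe_eq_mul_three (f g h : 𝓢(SpaceTime, ℂ)) :
    ∃ p : 𝓢(SpaceTime, ℂ), ⇑p = fun x => f x * g x * h x := by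
  obtain ⟨p, hp⟩ := SchwartzMap.exists_eq_mul f g
  obtain ⟨q, hq⟩ := SchwartzMap.exists_eq_mul p h
  exact ⟨q, funext fun x => by rw [hq, hp]⟩

lemma SchwartzMap.fourier_eq_convolution {f g p : 𝓢(SpaceTime, ℂ)} (hp : ∀ x, p x = f x * g x) :
    𝓕 p = SchwartzMap.convolution (ContinuousLinearMap.mul ℂ ℂ) (𝓕 f) (𝓕 g) := by
  have hneg : ∀ (q : 𝓢(SpaceTime, ℂ)) x, 𝓕 (𝓕 q) x = q (-x) := fun q x => by
    have h := Real.fourierInv_eq_fourier_neg (𝓕 q : 𝓢(SpaceTime, ℂ)) (-x)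
    rw [neg_neg, ← SchwartzMap.fourier_coe, ← SchwartzMap.fourierInv_coe] at h
    simpa using h.symm
  have hinj : 𝓕 (𝓕 p) =
      𝓕 (SchwartzMap.convolution (ContinuousLinearMap.mul ℂ ℂ) (𝓕 f) (𝓕 g)) := by
    rw [SchwartzMap.fourier_convolution]
    ext x
    change _ = 𝓕 (𝓕 f) x * 𝓕 (𝓕 g) x
    rw [hneg, hneg, hneg, hp]
  simpa using congrArg (𝓕⁻ ·) hinj

lemma enorm_fourier_mul_le {f g p : 𝓢(SpaceTime, ℂ)} (hp : ∀ x, p x = f x * g x)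
    (ζ : SpaceTime) :
    ‖𝓕 p ζ‖ₑ ≤ ∫⁻ η, ‖𝓕 f η‖ₑ * ‖𝓕 g (ζ - η)‖ₑ := by
  rw [SchwartzMap.fourier_eq_convolution hp, SchwartzMap.convolution_apply]
  refine (enorm_integral_le_lintegral_enorm _).trans (le_of_eq ?_)
  exact lintegral_congr fun η => by simp

lemma enorm_fourier_mul_three_le (u v w : 𝓢(SpaceTime, ℂ)) (ζ : SpaceTime) :
    ‖𝓕 (fun x => u x * v x * w x) ζ‖ₑ ≤
      ∫⁻ y, ∫⁻ x, ‖𝓕 u x‖ₑ * ‖𝓕 v (y - x)‖ₑ * ‖𝓕 w (ζ - y)‖ₑ := by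
  obtain ⟨p, hp⟩ := SchwartzMap.exists_eq_mul u v
  obtain ⟨q, hq⟩ := SchwartzMap.exists_eq_mul p w
  have hq' : (fun x => u x * v x * w x) = q := funext fun x => by rw [hq, hp]
  rw [hq', ← SchwartzMap.fourier_coe]
  refine (enorm_fourier_mul_le hq ζ).trans (lintegral_mono fun y => ?_)
  rw [lintegral_mul_const' _ _ (by finiteness)]
  gcongr
  exact enorm_fourier_mul_le hp y

/-! ### Weighted Fourier transforms -/

/-- The weighted modulus of the Fourier transform whose `L²` norm is `waveNorm s b f`. -/
def weightedFourier (s b : ℝ) (f : SpaceTime → ℂ) (ζ : SpaceTime) : ℝ≥0∞ :=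
  ENNReal.ofReal (spBracketSq ζ ^ (s / 2) * coneBracket ζ ^ b * ‖𝓕 f ζ‖)

lemma measurable_weightedFourier (s b : ℝ) {f : SpaceTime → ℂ} (hf : Measurable (𝓕 f)) :
    Measurable (weightedFourier s b f) := by
  unfold weightedFourier
  have := continuous_spBracketSq.measurable
  have := continuous_coneBracket.measurable
  fun_prop

lemma enorm_fourier_eq (s b : ℝ) (f : SpaceTime → ℂ) (ζ : SpaceTime) :
    ‖𝓕 f ζ‖ₑ = weightedFourier s b f ζ * (spKernel (s / 2) ζ * coneKernel b ζ) := by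
  have h1 := spBracketSq_pos ζ
  have h2 := coneBracket_pos ζ
  unfold weightedFourier spKernel coneKernel
  rw [← ENNReal.ofReal_mul (by positivity), ← ENNReal.ofReal_mul (by positivity),
    ← ofReal_norm]
  congr 1
  rw [Real.rpow_neg h1.le, Real.rpow_neg h2.le]
  field_simp

lemma weightedFourier_zero_eq (s : ℝ) (f : SpaceTime → ℂ) (ζ : SpaceTime) :
    weightedFourier s 0 f ζ = spKernel (-s / 2) ζ * ‖𝓕 f ζ‖ₑ := by
  have h1 := spBracketSq_pos ζ
  unfold weightedFourier spKernel
  rw [← ofReal_norm, ← ENNReal.ofReal_mul (by positivity), Real.rpow_zero, mul_one]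
  congr 3
  ring

/-- The integrand in the definition of `waveNorm`. -/
def waveIntegrand (s b : ℝ) (f : SpaceTime → ℂ) (ζ : SpaceTime) : ℝ :=
  (1 + (spFreq ζ) ^ 2) ^ s * (1 + |(|ζ 0| - spFreq ζ)|) ^ (2 * b) * ‖𝓕 f ζ‖ ^ 2

lemma waveIntegrand_nonneg (s b : ℝ) (f : SpaceTime → ℂ) (ζ : SpaceTime) :
    0 ≤ waveIntegrand s b f ζ := by
  unfold waveIntegrand; positivity

lemma waveNorm_nonneg (s b : ℝ) (f : SpaceTime → ℂ) : 0 ≤ waveNorm s b f :=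
  Real.rpow_nonneg (integral_nonneg (waveIntegrand_nonneg s b f)) _

lemma weightedFourier_sq (s b : ℝ) (f : SpaceTime → ℂ) (ζ : SpaceTime) :
    weightedFourier s b f ζ ^ 2 = ENNReal.ofReal (waveIntegrand s b f ζ) := by
  have h1 := spBracketSq_pos ζ
  have h2 := coneBracket_pos ζ
  unfold weightedFourier
  rw [← ENNReal.ofReal_pow (by positivity), mul_pow, mul_pow, ← Real.rpow_mul_natCast h1.le,
    ← Real.rpow_mul_natCast h2.le]
  unfold waveIntegrand spBracketSq coneBracket
  norm_num
  rw [mul_comm b 2]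

lemma ltwo_weightedFourier {s b : ℝ} {f : SpaceTime → ℂ} (hf : Integrable (waveIntegrand s b f)) :
    ltwo (weightedFourier s b f) = ENNReal.ofReal (waveNorm s b f) := by
  unfold ltwo waveNorm
  simp_rw [weightedFourier_sq]
  rw [← ofReal_integral_eq_lintegral_ofReal hf (ae_of_all _ (waveIntegrand_nonneg s b f)),
    ENNReal.ofReal_rpow_of_nonneg (integral_nonneg (waveIntegrand_nonneg s b f)) (by norm_num)]
  rfl

lemma spFreq_le_norm (ζ : SpaceTime) : spFreq ζ ≤ ‖ζ‖ := by
  rw [EuclideanSpace.norm_eq, spFreq]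
  refine Real.sqrt_le_sqrt ?_
  simp only [Fin.sum_univ_three, Real.norm_eq_abs, sq_abs]
  nlinarith [sq_nonneg (ζ 0)]

lemma waveWeight_le {s b : ℝ} (hs : s ≤ 1) (hb : b ≤ 1) (ζ : SpaceTime) :
    spBracketSq ζ ^ s * coneBracket ζ ^ (2 * b) ≤ (1 + ‖ζ‖) ^ 4 := by
  have h1 : spBracketSq ζ ^ s ≤ (1 + ‖ζ‖) ^ 2 := by
    refine (Real.rpow_le_rpow_of_exponent_le (one_le_spBracketSq ζ) hs).trans ?_
    rw [Real.rpow_one]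
    unfold spBracketSq
    nlinarith [spFreq_le_norm ζ, spFreq_nonneg ζ]
  have h2 : coneBracket ζ ^ (2 * b) ≤ (1 + ‖ζ‖) ^ 2 := by
    refine (Real.rpow_le_rpow_of_exponent_le (one_le_coneBracket ζ)
      (show 2 * b ≤ 2 by linarith)).trans ?_
    rw [Real.rpow_two]
    have h0 : |ζ 0| ≤ ‖ζ‖ := PiLp.norm_apply_le ζ 0
    refine pow_le_pow_left₀ (coneBracket_pos ζ).le ?_ 2
    unfold coneBracket
    have := abs_sub_le_iff.2 ⟨show |ζ 0| - spFreq ζ ≤ ‖ζ‖ by linarith [spFreq_nonneg ζ],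
      show spFreq ζ - |ζ 0| ≤ ‖ζ‖ by linarith [spFreq_le_norm ζ, abs_nonneg (ζ 0)]⟩
    linarith
  have h3 : 0 ≤ coneBracket ζ ^ (2 * b) := Real.rpow_nonneg (coneBracket_pos ζ).le _
  calc _ ≤ (1 + ‖ζ‖) ^ 2 * (1 + ‖ζ‖) ^ 2 := by gcongr
    _ = _ := by ring

lemma integrable_waveIntegrand {s b : ℝ} (hs : s ≤ 1) (hb : b ≤ 1) (u : 𝓢(SpaceTime, ℂ)) :
    Integrable (waveIntegrand s b u) := by
  obtain ⟨C, hC⟩ : ∃ C : ℝ, ∀ ζ, (1 + ‖ζ‖) ^ 4 * ‖𝓕 u ζ‖ ≤ C :=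
    ⟨_, fun ζ => by
      simpa only [norm_iteratedFDeriv_zero] using SchwartzMap.one_add_le_sup_seminorm_apply
        (𝕜 := ℝ) (m := (4, 0)) (k := 4) (n := 0) le_rfl le_rfl (𝓕 u) ζ⟩
  have hm : AEStronglyMeasurable (waveIntegrand s b u) := by
    have : Measurable (waveIntegrand s b u) := by
      unfold waveIntegrand
      rw [← SchwartzMap.fourier_coe]
      have := continuous_spFreq.measurable
      have := (𝓕 u).continuous.measurable
      fun_prop
    exact this.aestronglyMeasurable
  refine ((𝓕 u).integrable.norm.const_mul C).mono' hm (ae_of_all _ fun ζ => ?_)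
  rw [Real.norm_of_nonneg (waveIntegrand_nonneg s b u ζ)]
  unfold waveIntegrand
  rw [← SchwartzMap.fourier_coe]
  calc _ ≤ (1 + ‖ζ‖) ^ 4 * ‖𝓕 u ζ‖ ^ 2 := by
        gcongr; exact waveWeight_le hs hb ζ
    _ = ((1 + ‖ζ‖) ^ 4 * ‖𝓕 u ζ‖) * ‖𝓕 u ζ‖ := by ring
    _ ≤ _ := by gcongr; exact hC ζ

/-! ### The trilinear estimate -/

lemma coneKernel_le_one {θ : ℝ} (hθ : 0 ≤ θ) (ζ : SpaceTime) : coneKernel θ ζ ≤ 1 := by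
  unfold coneKernel
  rw [ENNReal.ofReal_le_one]
  exact Real.rpow_le_one_of_one_le_of_nonpos (one_le_coneBracket ζ) (by linarith)

lemma coneKernel_anti {θ θ' : ℝ} (h : θ ≤ θ') (ζ : SpaceTime) :
    coneKernel θ' ζ ≤ coneKernel θ ζ :=
  ENNReal.ofReal_le_ofReal
    (Real.rpow_le_rpow_of_exponent_le (one_le_coneBracket ζ) (by linarith))

lemma spKernel_mul_le_sum {p q r t σ : ℝ} (hp : 0 ≤ p) (hq : 0 ≤ q) (hr : 0 ≤ r) (ht : 0 ≤ t)
    (hpσ : p ≤ σ) (hqσ : q ≤ σ) (hrσ : r ≤ σ) (htσ : t ≤ σ) (hsum : p + q + r + t = 2 * σ)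
    (a b c d : SpaceTime) :
    spKernel p a * spKernel q b * spKernel r c * spKernel t d ≤
      spKernel σ a * spKernel σ b + spKernel σ a * spKernel σ c + spKernel σ a * spKernel σ d +
        spKernel σ b * spKernel σ c + spKernel σ b * spKernel σ d +
          spKernel σ c * spKernel σ d := by
  have h := rpow_weights_le_sum (spBracketSq_pos a) (spBracketSq_pos b) (spBracketSq_pos c)
    (spBracketSq_pos d) hp hq hr ht hpσ hqσ hrσ htσ hsum
  have nn : ∀ (ζ : SpaceTime) (e : ℝ), 0 ≤ spBracketSq ζ ^ e :=
    fun ζ e => Real.rpow_nonneg (spBracketSq_pos ζ).le _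
  have hn := fun ζ => nn ζ (-σ)
  unfold spKernel
  have hmul : ∀ (ζ : SpaceTime) (e y : ℝ), ENNReal.ofReal (spBracketSq ζ ^ e) * ENNReal.ofReal y =
    ENNReal.ofReal (spBracketSq ζ ^ e * y) := fun ζ e y => (ENNReal.ofReal_mul (nn ζ e)).symm
  simp only [mul_assoc] at h ⊢
  simp only [hmul]
  have ha := hn a
  have hb := hn b
  have hc := hn c
  have hd := hn d
  rw [← ENNReal.ofReal_add, ← ENNReal.ofReal_add, ← ENNReal.ofReal_add, ← ENNReal.ofReal_add,
    ← ENNReal.ofReal_add]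
  · exact ENNReal.ofReal_le_ofReal h
  all_goals positivity

lemma kernel_mul_le_pair_weights {p q r t σ θ θ₀ θ₁ : ℝ} (hp : 0 ≤ p) (hq : 0 ≤ q) (hr : 0 ≤ r)
    (ht : 0 ≤ t) (hpσ : p ≤ σ) (hqσ : q ≤ σ) (hrσ : r ≤ σ) (htσ : t ≤ σ)
    (hsum : p + q + r + t = 2 * σ) (hθ : 0 ≤ θ) (h₀ : θ ≤ θ₀) (h₁ : θ ≤ θ₁)
    (a x y z : SpaceTime) :
    spKernel p a * ((spKernel q x * coneKernel θ₁ x) * (spKernel r y * coneKernel θ₀ y) *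
        (spKernel t z * coneKernel θ₀ z)) ≤
      spKernel σ a * (spKernel σ x * coneKernel θ x) * coneKernel θ y +
        spKernel σ a * (spKernel σ y * coneKernel θ y) * coneKernel θ x +
        spKernel σ a * (spKernel σ z * coneKernel θ z) * coneKernel θ x +
        (spKernel σ x * coneKernel θ x) * (spKernel σ y * coneKernel θ y) +
        (spKernel σ x * coneKernel θ x) * (spKernel σ z * coneKernel θ z) +
        (spKernel σ y * coneKernel θ y) * (spKernel σ z * coneKernel θ z) := by
  have hx := coneKernel_le_one hθ x
  have hy := coneKernel_le_one hθ y
  have hz := coneKernel_le_one hθ z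
  calc _ ≤ spKernel p a * ((spKernel q x * coneKernel θ x) * (spKernel r y * coneKernel θ y) *
        (spKernel t z * coneKernel θ z)) := by
        gcongr <;> exact coneKernel_anti ‹_› _
    _ = (spKernel p a * spKernel q x * spKernel r y * spKernel t z) *
        (coneKernel θ x * coneKernel θ y * coneKernel θ z) := by ring
    _ ≤ _ := mul_le_mul_left (spKernel_mul_le_sum hp hq hr ht hpσ hqσ hrσ htσ hsum a x y z) _
    _ = (spKernel σ a * (spKernel σ x * coneKernel θ x) * coneKernel θ y) * coneKernel θ z +
        (spKernel σ a * (spKernel σ y * coneKernel θ y) * coneKernel θ x) * coneKernel θ z +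
        (spKernel σ a * (spKernel σ z * coneKernel θ z) * coneKernel θ x) * coneKernel θ y +
        ((spKernel σ x * coneKernel θ x) * (spKernel σ y * coneKernel θ y)) * coneKernel θ z +
        ((spKernel σ x * coneKernel θ x) * (spKernel σ z * coneKernel θ z)) * coneKernel θ y +
        ((spKernel σ y * coneKernel θ y) * (spKernel σ z * coneKernel θ z)) * coneKernel θ x := by
        ring
    _ ≤ _ := by
        repeat' refine add_le_add ?_ ?_
        all_goals exact mul_le_of_le_one_right' ‹_›

lemma le_of_sq_le_mul {a b : ℝ≥0∞} (ha : a ≠ ∞) (h : a ^ 2 ≤ b * a) : a ≤ b := by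
  rcases eq_or_ne a 0 with h0 | h0
  · simp [h0]
  · rw [pow_two] at h
    exact (ENNReal.mul_le_mul_iff_left h0 ha).1 h

lemma ltwo_sq {α : Type*} [MeasureSpace α] (f : α → ℝ≥0∞) : ltwo f ^ 2 = ∫⁻ x, f x ^ 2 := by
  unfold ltwo
  rw [← ENNReal.rpow_two, ← ENNReal.rpow_mul]
  norm_num

lemma exists_ltwo_weightedFourier_le {s s' θ₀ θ₁ : ℝ} (hs : 1 / 2 < s)
    (hs' : 0 ≤ s') (hs'1 : s' ≤ 1) (hθ0 : 1 / 2 < θ₀) (hθ1 : 1 / 2 < θ₁) :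
    ∃ K : ℝ≥0∞, K ≠ ∞ ∧ ∀ u v w : 𝓢(SpaceTime, ℂ),
      ltwo (weightedFourier (s' - 1) 0 fun x => u x * v x * w x) ≠ ∞ →
      ltwo (weightedFourier (s' - 1) 0 fun x => u x * v x * w x) ≤
        K * (ltwo (weightedFourier s' θ₁ u) * ltwo (weightedFourier s θ₀ v) *
          ltwo (weightedFourier s θ₀ w)) := by
  set σ := (1 + 2 * s) / 4 with hσ
  set θ := min θ₀ θ₁ with hθ
  have hθ2 : 1 / 2 < θ := lt_min hθ0 hθ1
  obtain ⟨K, hKt, hK⟩ := exists_lintegral_kernel_sq_le (σ := σ) (by linarith) hθ2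
  refine ⟨6 * K, by finiteness, fun u v w hfin => le_of_sq_le_mul hfin ?_⟩
  set Z := weightedFourier (s' - 1) 0 fun x => u x * v x * w x with hZ
  have hF : ∀ f : 𝓢(SpaceTime, ℂ), Measurable (𝓕 (f : SpaceTime → ℂ)) := fun f => by
    rw [← SchwartzMap.fourier_coe]; exact (𝓕 f).continuous.measurable
  have hZm : Measurable Z := by
    obtain ⟨q, hq⟩ := SchwartzMap.exists_coe_eq_mul_three u v w
    rw [hZ, ← hq]
    exact measurable_weightedFourier _ _ (hF q)
  have hum := measurable_weightedFourier s' θ₁ (hF u)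
  have hvm := measurable_weightedFourier s θ₀ (hF v)
  have hwm := measurable_weightedFourier s θ₀ (hF w)
  calc ltwo Z ^ 2 = ∫⁻ ζ, Z ζ ^ 2 := ltwo_sq Z
    _ ≤ ∫⁻ ζ, (Z ζ * spKernel ((1 - s') / 2) ζ) *
          ∫⁻ y, ∫⁻ x, ‖𝓕 u x‖ₑ * ‖𝓕 v (y - x)‖ₑ * ‖𝓕 w (ζ - y)‖ₑ := by
        refine lintegral_mono fun ζ => ?_
        rw [pow_two, mul_assoc]
        gcongr
        rw [hZ, weightedFourier_zero_eq, neg_sub]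
        gcongr
        exact enorm_fourier_mul_three_le u v w ζ
    _ = ∫⁻ x, ∫⁻ y, ∫⁻ z, ‖𝓕 u x‖ₑ * ‖𝓕 v y‖ₑ * ‖𝓕 w z‖ₑ *
          (Z (x + y + z) * spKernel ((1 - s') / 2) (x + y + z)) :=
        lintegral_mul_convolution_three (A := fun ζ => Z ζ * spKernel ((1 - s') / 2) ζ)
          (by fun_prop) (𝓕 u).continuous.measurable.enorm (𝓕 v).continuous.measurable.enorm
          (𝓕 w).continuous.measurable.enorm
    _ ≤ _ := by
        refine lintegral_mono fun x => lintegral_mono fun y => lintegral_mono fun z => ?_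
        have h := kernel_mul_le_pair_weights (p := (1 - s') / 2) (q := s' / 2) (r := s / 2)
          (t := s / 2) (σ := σ) (θ := θ) (by linarith) (by linarith) (by linarith)
          (by linarith) (by linarith) (by linarith) (by linarith) (by linarith) (by linarith)
          (by linarith) (min_le_left θ₀ θ₁) (min_le_right θ₀ θ₁) (x + y + z) x y z
        simp only [SchwartzMap.fourier_coe]
        rw [enorm_fourier_eq s' θ₁ u x, enorm_fourier_eq s θ₀ v y, enorm_fourier_eq s θ₀ w z]
        refine le_trans (le_of_eq ?_) (mul_le_mul_right (mul_le_mul_right h _) _)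
        ring
    _ ≤ 6 * K * (ltwo Z * ltwo (weightedFourier s' θ₁ u) * ltwo (weightedFourier s θ₀ v) *
          ltwo (weightedFourier s θ₀ w)) :=
        lintegral_pair_weights_le (k := fun x => spKernel σ x * coneKernel θ x) (j := spKernel σ)
          (m := coneKernel θ) hZm hum hvm hwm (by fun_prop) (by fun_prop) (by fun_prop)
          (by simpa using hK 0) hK
    _ = _ := by ring

theorem cubic_A_estimate (s s' θ₀ θ₁ : ℝ)
    (hs : 1/2 < s) (hs1 : s ≤ 1) (hs' : 1/4 < s') (hs'1 : s' ≤ 1)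
    (hθ0 : 1/2 < θ₀) (hθ0b : θ₀ < 1) (hθ1 : 1/2 < θ₁) (hθ1b : θ₁ < 1) :
    ∃ C > 0, ∀ u v w : SchwartzMap SpaceTime ℂ,
      waveNorm (s' - 1) 0 (fun x => u x * v x * w x) ≤
        C * waveNorm s' θ₁ (fun x => u x) * waveNorm s θ₀ (fun x => v x) *
          waveNorm s θ₀ (fun x => w x) := by
  obtain ⟨K, hKt, hK⟩ :=
    exists_ltwo_weightedFourier_le hs (by linarith : 0 ≤ s') hs'1 hθ0 hθ1
  refine ⟨K.toReal + 1, by positivity, fun u v w => ?_⟩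
  have hu := waveNorm_nonneg s' θ₁ u
  have hv := waveNorm_nonneg s θ₀ v
  have hw := waveNorm_nonneg s θ₀ w
  have hint : Integrable (waveIntegrand (s' - 1) 0 fun x => u x * v x * w x) := by
    obtain ⟨q, hq⟩ := SchwartzMap.exists_coe_eq_mul_three u v w
    rw [← hq]
    exact integrable_waveIntegrand (by linarith) zero_le_one q
  have h := hK u v w (by rw [ltwo_weightedFourier hint]; finiteness)
  rw [ltwo_weightedFourier hint, ltwo_weightedFourier (integrable_waveIntegrand hs'1 hθ1b.le u),
    ltwo_weightedFourier (integrable_waveIntegrand hs1 hθ0b.le v),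
    ltwo_weightedFourier (integrable_waveIntegrand hs1 hθ0b.le w),
    ← ENNReal.ofReal_toReal hKt, ← ENNReal.ofReal_mul hu, ← ENNReal.ofReal_mul (by positivity),
    ← ENNReal.ofReal_mul (by positivity), ENNReal.ofReal_le_ofReal_iff (by positivity)] at h
  have hprod := mul_nonneg (mul_nonneg hu hv) hw
  calc _ ≤ K.toReal * (waveNorm s' θ₁ u * waveNorm s θ₀ v * waveNorm s θ₀ w) := h
    _ ≤ (K.toReal + 1) * (waveNorm s' θ₁ u * waveNorm s θ₀ v * waveNorm s θ₀ w) := by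
        nlinarith
    _ = _ := by ring

end
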